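/- arXiv:2109.09592 — 2 statements merged into one kernel-verified Lean document; each statement's English description precedes it below -/
import Mathlib

section
/- Let S be a finite nonempty type and γ ∈ (0,1). Let P and P′ be S×S real row-stochastic matrices (all entries nonnegative, each row sums to 1), and let c, c′ : S → ℝ. Suppose v : S → ℝ satisfies v = c + γ • P.mulVec v, suppose v′ : S → ℝ satisfies v′ = c′ + γ • P′.mulVec v′, and suppose the greedy-improvement inequality c′ s + γ · (P′.mulVec v) s ≤ v s holds for every s. Then v′ s ≤ v s for every s (the improved policy is at least as good as the current one). -/
/-- A maximum principle: a vector dominated by its own discounted average under a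
row-stochastic matrix is nonpositive. -/
theorem nonpos_of_le_discounted_mulVec {S : Type*} [Fintype S] {γ : ℝ} (hγ0 : 0 ≤ γ)
    (hγ1 : γ < 1) {P : Matrix S S ℝ} (hP0 : ∀ i j, 0 ≤ P i j) (hP1 : ∀ i, ∑ j, P i j = 1)
    {d : S → ℝ} (hd : ∀ s, d s ≤ γ * P.mulVec d s) (s : S) : d s ≤ 0 := by
  have : Nonempty S := ⟨s⟩
  obtain ⟨m, hm⟩ := Finite.exists_max d
  have havg : P.mulVec d m ≤ d m := by
    calc P.mulVec d m = ∑ j, P m j * d j := rfl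
      _ ≤ ∑ j, P m j * d m :=
        Finset.sum_le_sum fun j _ => mul_le_mul_of_nonneg_left (hm j) (hP0 m j)
      _ = d m := by rw [← Finset.sum_mul, hP1, one_mul]
  have hmax : d m ≤ γ * d m := (hd m).trans (mul_le_mul_of_nonneg_left havg hγ0)
  have hm0 : d m ≤ 0 := by nlinarith
  exact (hm s).trans hm0


/-- Policy improvement: if `v` is the value of the current policy `(c, P)`, `v'` is the
value of the new policy `(c', P')`, and the greedy-improvement inequality
`c' + γ P' v ≤ v` holds componentwise, then `v' ≤ v` componentwise. -/
theorem stochastic_csp_policy_improvement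
    (S : Type*) [Fintype S] [Nonempty S]
    (γ : ℝ) (hγ : γ ∈ Set.Ioo (0 : ℝ) 1)
    (P P' : Matrix S S ℝ)
    (hP0 : ∀ i j, 0 ≤ P i j) (hP1 : ∀ i, ∑ j, P i j = 1)
    (hP'0 : ∀ i j, 0 ≤ P' i j) (hP'1 : ∀ i, ∑ j, P' i j = 1)
    (c c' : S → ℝ) (v v' : S → ℝ)
    (hv : v = c + γ • P.mulVec v)
    (hv' : v' = c' + γ • P'.mulVec v')
    (hgreedy : ∀ s, c' s + γ * P'.mulVec v s ≤ v s) :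
    ∀ s, v' s ≤ v s := by
  have hsub : ∀ s, (v' - v) s ≤ γ * P'.mulVec (v' - v) s := by
    intro s
    have h := congrFun hv' s
    simp only [Pi.add_apply, Pi.smul_apply, smul_eq_mul] at h
    rw [Matrix.mulVec_sub, Pi.sub_apply, Pi.sub_apply, mul_sub]
    linarith [hgreedy s]
  intro s
  have h := nonpos_of_le_discounted_mulVec hγ.1.le hγ.2 hP'0 hP'1 hsub s
  rwa [Pi.sub_apply, sub_nonpos] at h
end

section
/- Let N and K be positive natural numbers, let Φ and Φ̄ be real N×K matrices, let Ξ be a real N×N diagonal matrix with strictly positive diagonal entries, let c̄ ∈ ℝ^N, and let γ ∈ ℝ. Suppose Φᵀ Ξ Φ is invertible, and suppose the K×K matrix A := Φᵀ Ξ (Φ − γ • Φ̄) is invertible. Define b := (Φᵀ Ξ).mulVec c̄ and Π := Φ (Φᵀ Ξ Φ)⁻¹ Φᵀ Ξ. Then θ := A⁻¹.mulVec b is the unique θ ∈ ℝ^K satisfying the projected Bellman equation Φ.mulVec θ = Π.mulVec (c̄ + γ • Φ̄.mulVec θ). -/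
open Matrix

/-- The oblique projection `Φ (LΦ)⁻¹ L` onto the column span of `Φ` is characterised by the
normal equations. -/
theorem mulVec_eq_projection_mulVec_iff {m n R : Type*} [Fintype m] [Fintype n] [DecidableEq n]
    [CommRing R] (Φ : Matrix m n R) (L : Matrix n m R) (h : IsUnit (L * Φ))
    (x : n → R) (v : m → R) :
    Φ *ᵥ x = (Φ * (L * Φ)⁻¹ * L) *ᵥ v ↔ (L * Φ) *ᵥ x = L *ᵥ v := by
  have hdet := (isUnit_iff_isUnit_det _).1 h
  constructor
  · intro hx
    rw [← mulVec_mulVec, hx, mulVec_mulVec, ← Matrix.mul_assoc, ← Matrix.mul_assoc,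
      mul_nonsing_inv _ hdet, Matrix.one_mul]
  · intro hx
    rw [← mulVec_mulVec, ← hx, mulVec_mulVec, Matrix.mul_assoc, nonsing_inv_mul _ hdet,
      Matrix.mul_one]

/-- If `A = ΦᵀΞ(Φ - γΦ̄)` is invertible, then `θ = A⁻¹ b` with `b = ΦᵀΞ c̄` is the
unique solution of the projected Bellman equation `Φθ = Proj (c̄ + γ Φ̄ θ)`. -/
theorem projected_bellman_unique_solution
    (N K : ℕ) (hN : 0 < N) (hK : 0 < K)
    (Φ Φb : Matrix (Fin N) (Fin K) ℝ)
    (ξ : Fin N → ℝ) (hξ : ∀ i, 0 < ξ i)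
    (cb : Fin N → ℝ) (γ : ℝ)
    (hinv : IsUnit (Φᵀ * Matrix.diagonal ξ * Φ))
    (A : Matrix (Fin K) (Fin K) ℝ)
    (hA : A = Φᵀ * Matrix.diagonal ξ * (Φ - γ • Φb))
    (hAinv : IsUnit A)
    (b : Fin K → ℝ)
    (hb : b = (Φᵀ * Matrix.diagonal ξ).mulVec cb)
    (Proj : Matrix (Fin N) (Fin N) ℝ)
    (hProj : Proj = Φ * (Φᵀ * Matrix.diagonal ξ * Φ)⁻¹ * Φᵀ * Matrix.diagonal ξ)
    (θs : Fin K → ℝ) (hθs : θs = A⁻¹.mulVec b) :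
    Φ.mulVec θs = Proj.mulVec (cb + γ • Φb.mulVec θs) ∧
      ∀ θ : Fin K → ℝ,
        Φ.mulVec θ = Proj.mulVec (cb + γ • Φb.mulVec θ) → θ = θs := by
  have hdet := (isUnit_iff_isUnit_det _).1 hAinv
  have key (θ : Fin K → ℝ) :
      Φ.mulVec θ = Proj.mulVec (cb + γ • Φb.mulVec θ) ↔ A.mulVec θ = b := by
    rw [hProj, Matrix.mul_assoc _ Φᵀ, mulVec_eq_projection_mulVec_iff _ _ hinv, hA, hb,
      Matrix.mul_sub, sub_mulVec, mulVec_add, sub_eq_iff_eq_add, Matrix.mul_smul, smul_mulVec,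
      mulVec_smul, mulVec_mulVec]
  subst hθs
  refine ⟨(key _).2 ?_, fun θ hθ ↦ ?_⟩
  · rw [mulVec_mulVec, mul_nonsing_inv _ hdet, one_mulVec]
  · rw [← (key θ).1 hθ, mulVec_mulVec, nonsing_inv_mul _ hdet, one_mulVec]
end
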